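/- arXiv:1806.01325 — 3 statements merged into one kernel-verified Lean document; each statement's English description precedes it below -/
import Mathlib

section
/- Let Z ~ N(0, I_n), let F ⊆ ℝⁿ be a cone with P(Z ∈ F) > 0, let F° = {μ : μᵀy ≤ 0 for all y ∈ F} be its polar cone, and let q > 0. Then for every μ ∈ F°, P(‖Z + μ‖ > q | Z + μ ∈ F) ≤ P(‖Z‖ > q | Z ∈ F). -/
open MeasureTheory ProbabilityTheory

lemma pi_gaussian_density (n : ℕ) (m : Fin n → ℝ) :
    Measure.pi (fun i => gaussianReal (m i) 1) =
      (volume : Measure (Fin n → ℝ)).withDensity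
        (fun x => ENNReal.ofReal (∏ i, gaussianPDFReal (m i) 1 (x i))) := by
  refine Measure.pi_eq fun s hs => ?_
  have hms : MeasurableSet (Set.univ.pi s) := MeasurableSet.univ_pi hs
  rw [withDensity_apply _ hms, ← lintegral_indicator hms]
  set f : (i : Fin n) → ℝ → ℝ := fun i => (s i).indicator (gaussianPDFReal (m i) 1) with hf
  have hfi : ∀ i, Integrable (f i) := fun i =>
    (integrable_gaussianPDFReal _ _).indicator (hs i)
  have hf0 : ∀ i x, 0 ≤ f i x := fun i x =>
    Set.indicator_nonneg (fun _ _ => gaussianPDFReal_nonneg _ _ _) _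
  have h1 : (Set.univ.pi s).indicator
      (fun x => ENNReal.ofReal (∏ i, gaussianPDFReal (m i) 1 (x i)))
      = fun x => ENNReal.ofReal (∏ i, f i (x i)) := by
    ext x
    by_cases hx : x ∈ Set.univ.pi s
    · rw [Set.indicator_of_mem hx]
      congr 1
      refine Finset.prod_congr rfl fun i _ => ?_
      rw [hf]; simp only
      rw [Set.indicator_of_mem (hx i trivial)]
    · rw [Set.indicator_of_notMem hx]
      simp only [Set.mem_pi, Set.mem_univ, true_imp_iff, not_forall] at hx
      obtain ⟨i, hi⟩ := hx
      rw [Finset.prod_eq_zero (Finset.mem_univ i), ENNReal.ofReal_zero]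
      simp [hf, hi]
  rw [h1, ← ofReal_integral_eq_lintegral_ofReal, integral_fintype_prod_volume_eq_prod,
    ENNReal.ofReal_prod_of_nonneg]
  · refine Finset.prod_congr rfl fun i _ => ?_
    rw [gaussianReal_apply_eq_integral _ one_ne_zero, hf]
    simp only
    rw [integral_indicator (hs i)]
  · intro i _; exact integral_nonneg (hf0 i)
  · exact Integrable.fintype_prod hfi
  · exact ae_of_all _ fun x => Finset.prod_nonneg fun i _ => hf0 i _

lemma pi_gaussian_shift (n : ℕ) (m : Fin n → ℝ) {A : Set (Fin n → ℝ)} (hA : MeasurableSet A) :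
    (Measure.pi fun _ : Fin n => gaussianReal 0 1) {z | (fun i => z i + m i) ∈ A} =
    Measure.pi (fun i => gaussianReal (m i) 1) A := by
  have h : Measure.pi (fun i => gaussianReal (m i) 1) =
    (Measure.pi fun _ : Fin n => gaussianReal 0 1).map (fun z i => z i + m i) := by
    rw [Measure.pi_map_pi (f := fun i x => x + m i) (fun i => by fun_prop)]
    simp [gaussianReal_map_add_const]
  rw [h, Measure.map_apply (by fun_prop) hA]; rfl

lemma polar_lintegral {E : Type*} [NormedAddCommGroup E] [NormedSpace ℝ E] [MeasurableSpace E]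
    [BorelSpace E] [FiniteDimensional ℝ E] [Nontrivial E] (μ : Measure E) [μ.IsAddHaarMeasure]
    {f : E → ENNReal} (hf : Measurable f) :
    ∫⁻ x, f x ∂μ = ∫⁻ θ, ∫⁻ r, f ((r : ℝ) • (θ : E))
      ∂(Measure.volumeIoiPow (Module.finrank ℝ E - 1)) ∂μ.toSphere := by
  have h := μ.measurePreserving_homeomorphUnitSphereProd
  have h2 := h.symm (homeomorphUnitSphereProd E).toMeasurableEquiv
  rw [← lintegral_prod (fun p : Metric.sphere (0:E) 1 × Set.Ioi (0:ℝ) => f ((p.2 : ℝ) • (p.1 : E)))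
    (by fun_prop)]
  have h3 := h2.lintegral_comp (f := fun x : ({0}ᶜ : Set E) => f x) (by fun_prop)
  conv_lhs =>
    rw [← restrict_compl_singleton (μ := μ) 0, ← lintegral_subtype_comap (by measurability), ← h3]
  rfl

lemma key_lintegral {S R : Type*} [MeasurableSpace S] [MeasurableSpace R] (σ : Measure S)
    (ν : Measure R) [SFinite ν] [SFinite σ] (φ : R → ENNReal) (hφ : Measurable φ)
    (W : S → R → ENNReal) (hW : Measurable fun p : S × R => W p.1 p.2) (w0 : S → ENNReal)
    (T : Set S) (hT : MeasurableSet T) (U : Set R) (hU : MeasurableSet U)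
    (h1 : ∀ θ ∈ T, ∀ r ∈ U, W θ r ≤ w0 θ) (h2 : ∀ θ ∈ T, ∀ r ∈ Uᶜ, w0 θ ≤ W θ r) :
    (∫⁻ θ in T, ∫⁻ r in U, φ r * W θ r ∂ν ∂σ) * (∫⁻ _ in T, ∫⁻ r in Uᶜ, φ r ∂ν ∂σ) ≤
    (∫⁻ θ in T, ∫⁻ r in Uᶜ, φ r * W θ r ∂ν ∂σ) * (∫⁻ _ in T, ∫⁻ r in U, φ r ∂ν ∂σ) := by
  have hm : ∀ V : Set R, Measurable fun θ => ∫⁻ r in V, φ r * W θ r ∂ν := fun V =>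
    Measurable.lintegral_prod_right' (f := fun p : S × R => φ p.2 * W p.1 p.2) (by fun_prop)
  rw [lintegral_const, lintegral_const, ← mul_assoc, ← mul_assoc]
  gcongr ?_ * _
  rw [← lintegral_mul_const _ (hm _), ← lintegral_mul_const _ (hm _)]
  refine setLIntegral_mono' hT fun θ hθ => ?_
  calc _ ≤ (∫⁻ r in U, φ r * w0 θ ∂ν) * ∫⁻ r in Uᶜ, φ r ∂ν := by
        gcongr ?_ * _
        exact setLIntegral_mono' hU fun r hr => by gcongr; exact h1 θ hθ r hr
    _ = (∫⁻ r in Uᶜ, φ r * w0 θ ∂ν) * ∫⁻ r in U, φ r ∂ν := by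
        rw [lintegral_mul_const _ hφ, lintegral_mul_const _ hφ]; ring
    _ ≤ _ := by
        gcongr ?_ * _
        exact setLIntegral_mono' hU.compl fun r hr => by gcongr; exact h2 θ hθ r hr

lemma ratio_le {a b c d : ENNReal} (ha : a ≠ ⊤) (hb : b ≠ ⊤) (hc : c ≠ ⊤) (hd : d ≠ ⊤)
    (hab : a + b ≠ 0) (hcd : c + d ≠ 0) (h : a * d ≤ b * c) : a / (a + b) ≤ c / (c + d) := by
  rw [ENNReal.div_le_iff hab (by finiteness), ENNReal.mul_comm_div, ← mul_div_assoc,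
    ENNReal.le_div_iff_mul_le (by left; exact hcd) (by left; finiteness)]
  calc a * (c + d) = a * c + a * d := by ring
    _ ≤ a * c + b * c := by gcongr
    _ = _ := by ring

lemma gauss_prod {n : ℕ} (m : Fin n → ℝ) (θ : EuclideanSpace ℝ (Fin n)) (hθ : ‖θ‖ = 1) (r : ℝ) :
    ∏ i, gaussianPDFReal (m i) 1 (r * θ i) =
      ((√(2 * Real.pi))⁻¹ ^ n * Real.exp (-r ^ 2 / 2)) *
        Real.exp (r * ∑ i, m i * θ i - (∑ i, m i ^ 2) / 2) := by
  have h1 : ∑ i, θ i ^ 2 = 1 := by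
    have := EuclideanSpace.real_norm_sq_eq θ
    rw [hθ] at this; linarith
  simp only [gaussianPDFReal_def, NNReal.coe_one, mul_one]
  rw [Finset.prod_mul_distrib, ← Real.exp_sum, Finset.prod_const, Finset.card_univ,
    Fintype.card_fin, mul_assoc, ← Real.exp_add]
  congr 2
  have : ∀ i, -(r * θ i - m i) ^ 2 / 2 = -r ^ 2 / 2 * θ i ^ 2 + r * (m i * θ i) - m i ^ 2 / 2 := by
    intro i; ring
  simp only [this]
  rw [Finset.sum_sub_distrib, Finset.sum_add_distrib, ← Finset.mul_sum, ← Finset.mul_sum, h1,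
    Finset.sum_div]
  ring

lemma gauss_polar {n : ℕ} [Nontrivial (EuclideanSpace ℝ (Fin n))] (m : Fin n → ℝ)
    {A : Set (Fin n → ℝ)} (hA : MeasurableSet A)
    (T : Set (Metric.sphere (0 : EuclideanSpace ℝ (Fin n)) 1)) (hT : MeasurableSet T)
    (U : Set (Set.Ioi (0 : ℝ))) (hU : MeasurableSet U)
    (h : ∀ (θ : Metric.sphere (0 : EuclideanSpace ℝ (Fin n)) 1) (r : Set.Ioi (0 : ℝ)), WithLp.ofLp ((r : ℝ) • (θ : EuclideanSpace ℝ (Fin n))) ∈ A ↔ θ ∈ T ∧ r ∈ U) :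
    Measure.pi (fun i => gaussianReal (m i) 1) A =
    ∫⁻ θ in T, ∫⁻ r in U, ENNReal.ofReal ((√(2 * Real.pi))⁻¹ ^ n * Real.exp (-(r : ℝ) ^ 2 / 2)) *
        ENNReal.ofReal (Real.exp ((r : ℝ) * ∑ i, m i * (θ : EuclideanSpace ℝ (Fin n)) i
          - (∑ i, m i ^ 2) / 2))
      ∂(Measure.volumeIoiPow (Module.finrank ℝ (EuclideanSpace ℝ (Fin n)) - 1))
      ∂(volume : Measure (EuclideanSpace ℝ (Fin n))).toSphere := by
  have hD : Measurable (fun x : Fin n → ℝ =>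
      ENNReal.ofReal (∏ i, gaussianPDFReal (m i) 1 (x i))) := by
    refine ENNReal.measurable_ofReal.comp (Finset.measurable_prod _ fun i _ => ?_)
    exact (measurable_gaussianPDFReal _ _).comp (measurable_pi_apply i)
  rw [pi_gaussian_density, withDensity_apply _ hA, ← lintegral_indicator hA,
    ← (PiLp.volume_preserving_ofLp (Fin n)).lintegral_comp (hD.indicator hA),
    polar_lintegral (f := fun a : EuclideanSpace ℝ (Fin n) => A.indicator (fun x => ENNReal.ofReal (∏ i, gaussianPDFReal (m i) 1 (x i))) (WithLp.ofLp a)) _ ((hD.indicator hA).comp (PiLp.volume_preserving_ofLp (Fin n)).measurable),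
    ← lintegral_indicator hT]
  refine lintegral_congr fun θ => ?_
  by_cases hθ : θ ∈ T
  · rw [Set.indicator_of_mem hθ, ← lintegral_indicator hU]
    refine lintegral_congr fun r => ?_
    by_cases hr : r ∈ U
    · rw [Set.indicator_of_mem hr, Set.indicator_of_mem ((h θ r).2 ⟨hθ, hr⟩),
        ← ENNReal.ofReal_mul (by positivity), ← gauss_prod m θ (by simpa using θ.2)]
      rfl
    · rw [Set.indicator_of_notMem hr, Set.indicator_of_notMem (fun h' => hr ((h θ r).1 h').2)]
  · rw [Set.indicator_of_notMem hθ]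
    refine (lintegral_congr fun r => ?_).trans lintegral_zero
    rw [Set.indicator_of_notMem (fun h' => hθ ((h θ r).1 h').1)]

/-- conditional least favorable distribution over a cone:
for Z ~ N(0, Iₙ), F a cone, μ in the polar cone of F,
P(‖Z+μ‖ > q | Z+μ ∈ F) ≤ P(‖Z‖ > q | Z ∈ F). -/
theorem stmt5 (n : ℕ) (F : Set (Fin n → ℝ)) (hFmeas : MeasurableSet F)
    (hcone : ∀ t : ℝ, 0 < t → ∀ x ∈ F, t • x ∈ F)
    (μ : Fin n → ℝ) (hμ : ∀ y ∈ F, ∑ i, μ i * y i ≤ 0)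
    (q : ℝ) (hq : 0 < q)
    (hposF : 0 < (Measure.pi fun _ : Fin n => gaussianReal 0 1) F)
    (hposFμ : 0 < (Measure.pi fun _ : Fin n => gaussianReal 0 1)
      {z | (fun i => z i + μ i) ∈ F}) :
    (Measure.pi fun _ : Fin n => gaussianReal 0 1)
        {z | Real.sqrt (∑ i, (z i + μ i) ^ 2) > q ∧ (fun i => z i + μ i) ∈ F} /
      (Measure.pi fun _ : Fin n => gaussianReal 0 1) {z | (fun i => z i + μ i) ∈ F} ≤
    (Measure.pi fun _ : Fin n => gaussianReal 0 1)
        {z | Real.sqrt (∑ i, (z i) ^ 2) > q ∧ z ∈ F} /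
      (Measure.pi fun _ : Fin n => gaussianReal 0 1) F := by
  rcases Nat.eq_zero_or_pos n with rfl | hn
  · simp [hq.not_gt]
  have : Nonempty (Fin n) := ⟨⟨0, hn⟩⟩
  have : Nontrivial (EuclideanSpace ℝ (Fin n)) := by
    have : 0 < Module.finrank ℝ (EuclideanSpace ℝ (Fin n)) := by simpa using hn
    exact Module.nontrivial_of_finrank_pos this
  set N : Set (Fin n → ℝ) := {z | Real.sqrt (∑ i, (z i) ^ 2) > q} with hN
  have hNm : MeasurableSet N := by
    apply measurableSet_lt <;> fun_prop
  have e1 : {z | Real.sqrt (∑ i, (z i) ^ 2) > q ∧ z ∈ F} = F ∩ N := by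
    ext z; simp [hN, and_comm]
  have e2 : {z : Fin n → ℝ | Real.sqrt (∑ i, (z i + μ i) ^ 2) > q ∧ (fun i => z i + μ i) ∈ F}
      = {z | (fun i => z i + μ i) ∈ F ∩ N} := by
    ext z; simp [hN, and_comm]
  rw [pi_gaussian_shift n μ hFmeas] at hposFμ
  rw [e1, e2, pi_gaussian_shift n μ (hFmeas.inter hNm), pi_gaussian_shift n μ hFmeas]
  rw [← measure_inter_add_sdiff F hNm] at hposF hposFμ
  rw [← measure_inter_add_sdiff (μ := Measure.pi (fun i => gaussianReal (μ i) 1)) F hNm,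
    ← measure_inter_add_sdiff (μ := Measure.pi (fun i : Fin n => gaussianReal 0 1)) F hNm]
  refine ratio_le (measure_ne_top _ _) (measure_ne_top _ _) (measure_ne_top _ _)
    (measure_ne_top _ _) hposFμ.ne' hposF.ne' ?_
  set T : Set (Metric.sphere (0 : EuclideanSpace ℝ (Fin n)) 1) :=
    {θ | WithLp.ofLp (θ : EuclideanSpace ℝ (Fin n)) ∈ F} with hTdef
  have hT : MeasurableSet T :=
    ((PiLp.volume_preserving_ofLp (Fin n)).measurable.comp measurable_subtype_coe) hFmeas
  set U : Set (Set.Ioi (0 : ℝ)) := {r | q < r} with hUdef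
  have hU : MeasurableSet U := measurableSet_lt measurable_const measurable_subtype_coe
  have hFiff : ∀ (θ : Metric.sphere (0 : EuclideanSpace ℝ (Fin n)) 1) (r : Set.Ioi (0 : ℝ)),
      WithLp.ofLp ((r : ℝ) • (θ : EuclideanSpace ℝ (Fin n))) ∈ F ↔ θ ∈ T := by
    intro θ r
    have hr : (0 : ℝ) < r := r.2
    constructor
    · intro h
      have := hcone (r : ℝ)⁻¹ (inv_pos.2 hr) _ h
      rw [WithLp.ofLp_smul, smul_smul, inv_mul_cancel₀ hr.ne', one_smul] at this
      exact this
    · intro h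
      exact hcone r hr _ h
  have hNiff : ∀ (θ : Metric.sphere (0 : EuclideanSpace ℝ (Fin n)) 1) (r : Set.Ioi (0 : ℝ)),
      WithLp.ofLp ((r : ℝ) • (θ : EuclideanSpace ℝ (Fin n))) ∈ N ↔ r ∈ U := by
    intro θ r
    have hr : (0 : ℝ) < r := r.2
    have h1 : ‖(r : ℝ) • (θ : EuclideanSpace ℝ (Fin n))‖ = r := by
      rw [norm_smul, Real.norm_of_nonneg hr.le, show ‖(θ : EuclideanSpace ℝ (Fin n))‖ = 1 by
        simpa using θ.2, mul_one]
    rw [EuclideanSpace.norm_eq] at h1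
    simp only [Real.norm_eq_abs, sq_abs] at h1
    simp only [hN, hUdef, Set.mem_ofPred_eq, gt_iff_lt]
    rw [h1]
  have hg1 := fun m => gauss_polar m (hFmeas.inter hNm) T hT U hU (fun θ r => by
    rw [Set.mem_inter_iff, hFiff, hNiff])
  have hg2 := fun m => gauss_polar m (hFmeas.diff hNm) T hT Uᶜ hU.compl (fun θ r => by
    rw [Set.mem_sdiff, hFiff, hNiff]; rfl)
  have hg10 := hg1 (fun _ => 0)
  have hg20 := hg2 (fun _ => 0)
  simp only [zero_mul, Finset.sum_const_zero, mul_zero, ne_eq, OfNat.ofNat_ne_zero,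
    not_false_eq_true, zero_pow, zero_div, sub_zero, Real.exp_zero, ENNReal.ofReal_one,
    mul_one] at hg10 hg20
  rw [hg1 μ, hg2 μ, hg10, hg20]
  refine key_lintegral _ _ (fun r : Set.Ioi (0 : ℝ) =>
      ENNReal.ofReal ((√(2 * Real.pi))⁻¹ ^ n * Real.exp (-(r : ℝ) ^ 2 / 2))) (by fun_prop)
    (fun (θ : Metric.sphere (0 : EuclideanSpace ℝ (Fin n)) 1) (r : Set.Ioi (0 : ℝ)) => ENNReal.ofReal (Real.exp ((r : ℝ) *
    ∑ i, μ i * (θ : EuclideanSpace ℝ (Fin n)) i - (∑ i, μ i ^ 2) / 2))) (by fun_prop)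
    (fun θ : Metric.sphere (0 : EuclideanSpace ℝ (Fin n)) 1 => ENNReal.ofReal (Real.exp (q *
    ∑ i, μ i * (θ : EuclideanSpace ℝ (Fin n)) i - (∑ i, μ i ^ 2) / 2))) T hT U hU ?_ ?_
  · intro θ hθ r hr
    have h0 := hμ _ hθ
    have hr' : q < r := hr
    apply ENNReal.ofReal_le_ofReal
    apply Real.exp_le_exp.2
    have := mul_le_mul_of_nonpos_right hr'.le h0
    linarith
  · intro θ hθ r hr
    have h0 := hμ _ hθ
    have hr' : (r : ℝ) ≤ q := not_lt.1 hr
    apply ENNReal.ofReal_le_ofReal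
    apply Real.exp_le_exp.2
    have := mul_le_mul_of_nonpos_right hr' h0
    linarith
end

section
/- Let Z ~ N(0, I_n), let P be an orthogonal projection matrix of rank r ≥ 1, and let F be a cone contained in the range of P with P(PZ ∈ F) > 0. Then conditionally on PZ ∈ F, the distribution of ‖PZ‖² is chi-squared with r degrees of freedom. -/
open MeasureTheory ProbabilityTheory

/-- The chi-squared distribution with `k` degrees of freedom. -/
noncomputable def chiSq (k : ℕ) : Measure ℝ :=
  Measure.map (fun x : Fin k → ℝ => ∑ i, (x i) ^ 2)
    (Measure.pi fun _ : Fin k => gaussianReal 0 1)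

open scoped ENNReal Pointwise

lemma pi_gauss_density (r : ℕ) :
    (Measure.pi fun _ : Fin r => gaussianReal 0 1) =
      (volume : Measure (Fin r → ℝ)).withDensity
        (fun x => ENNReal.ofReal (∏ i, gaussianPDFReal 0 1 (x i))) := by
  refine Measure.pi_eq fun s hs => ?_
  rw [withDensity_apply _ (MeasurableSet.univ_pi hs)]
  rw [volume_pi, Measure.restrict_pi_pi]
  have hint : Integrable (fun x : Fin r → ℝ => ∏ i, gaussianPDFReal 0 1 (x i))
      (Measure.pi fun i => (volume : Measure ℝ).restrict (s i)) :=
    Integrable.fintype_prod (f := fun _ => gaussianPDFReal 0 1)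
      (fun i => (integrable_gaussianPDFReal 0 1).restrict)
  rw [← ofReal_integral_eq_lintegral_ofReal hint
    (ae_of_all _ fun x => Finset.prod_nonneg fun i _ => gaussianPDFReal_nonneg 0 1 _)]
  rw [integral_fintype_prod_eq_prod (f := fun _ => gaussianPDFReal 0 1),
    ENNReal.ofReal_prod_of_nonneg
      (fun i _ => integral_nonneg fun x => gaussianPDFReal_nonneg 0 1 x)]
  exact Finset.prod_congr rfl fun i _ =>
    (gaussianReal_apply_eq_integral 0 one_ne_zero (s i)).symm

lemma prod_pdf (r : ℕ) (x : Fin r → ℝ) :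
    ∏ i, gaussianPDFReal 0 1 (x i) =
      ((√(2 * Real.pi))⁻¹) ^ r * Real.exp (-(∑ i, x i ^ 2) / 2) := by
  simp only [gaussianPDFReal, Finset.prod_mul_distrib, ← Real.exp_sum]
  simp [neg_div, Finset.sum_div, Finset.sum_neg_distrib]

lemma vol_scale (r : ℕ) (G : Set (Fin r → ℝ))
    (hcone : ∀ t : ℝ, 0 < t → ∀ x ∈ G, t • x ∈ G) (s : ℝ) (hs : 0 < s) :
    (volume : Measure (Fin r → ℝ)) ({x | ∑ i, x i ^ 2 ≤ s} ∩ G) =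
      ENNReal.ofReal (√s ^ r) * volume ({x : Fin r → ℝ | ∑ i, x i ^ 2 ≤ 1} ∩ G) := by
  have h0 : 0 < √s := Real.sqrt_pos.2 hs
  have h2 : √s ^ 2 = s := Real.sq_sqrt hs.le
  have key : ({x : Fin r → ℝ | ∑ i, x i ^ 2 ≤ s} ∩ G) =
      √s • ({x : Fin r → ℝ | ∑ i, x i ^ 2 ≤ 1} ∩ G) := by
    ext x
    rw [Set.mem_smul_set_iff_inv_smul_mem₀ h0.ne']
    simp only [Set.mem_inter_iff, Set.mem_setOf_eq, Pi.smul_apply, smul_eq_mul, mul_pow,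
      ← Finset.mul_sum, inv_pow, h2]
    rw [inv_mul_le_iff₀ hs, mul_one]
    refine and_congr_right fun _ => ⟨fun h => hcone _ (inv_pos.2 h0) _ h, fun h => ?_⟩
    have := hcone _ h0 _ h
    rwa [smul_inv_smul₀ h0.ne'] at this
  rw [key, Measure.addHaar_smul_of_nonneg _ h0.le]
  simp

lemma vol_ball_lt (r : ℕ) (s : ℝ) :
    (volume : Measure (Fin r → ℝ)) {x | ∑ i, x i ^ 2 ≤ s} < ∞ := by
  refine lt_of_le_of_lt (measure_mono (t := Set.Icc (fun _ => -√s) (fun _ => √s)) ?_)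
    isCompact_Icc.measure_lt_top
  intro x hx
  have : ∀ i, |x i| ≤ √s := fun i =>
    Real.abs_le_sqrt ((Finset.single_le_sum (f := fun i => x i ^ 2)
      (fun i _ => sq_nonneg _) (Finset.mem_univ i)).trans hx)
  exact ⟨fun i => (abs_le.1 (this i)).1, fun i => (abs_le.1 (this i)).2⟩

lemma vol_ball_pos (r : ℕ) :
    (volume : Measure (Fin r → ℝ)) {x | ∑ i, x i ^ 2 ≤ 1} ≠ 0 := by
  have ho : IsOpen {x : Fin r → ℝ | ∑ i, x i ^ 2 < 1} :=
    isOpen_lt (by fun_prop) continuous_const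
  have := ho.measure_pos volume ⟨0, by simp⟩
  exact (this.trans_le (measure_mono fun x (hx : ∑ i, x i ^ 2 < 1) => hx.le)).ne'

lemma vol_zero (r : ℕ) (hr : 1 ≤ r) (s : ℝ) (hs : s ≤ 0) :
    (volume : Measure (Fin r → ℝ)) {x | ∑ i, x i ^ 2 ≤ s} = 0 := by
  have : Nonempty (Fin r) := ⟨⟨0, hr⟩⟩
  refine measure_mono_null (t := {0}) ?_ (by simp)
  intro x hx
  have h0 : ∑ i, x i ^ 2 = 0 :=
    le_antisymm (le_trans hx hs) (Finset.sum_nonneg fun i _ => sq_nonneg _)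
  rw [Finset.sum_eq_zero_iff_of_nonneg (fun i _ => sq_nonneg _)] at h0
  ext i
  simpa using h0 i (Finset.mem_univ i)

lemma map_vol_cone (r : ℕ) (hr : 1 ≤ r) (G : Set (Fin r → ℝ))
    (hcone : ∀ t : ℝ, 0 < t → ∀ x ∈ G, t • x ∈ G) :
    ∃ c : ℝ≥0∞, Measure.map (fun x : Fin r → ℝ => ∑ i, x i ^ 2) (volume.restrict G) =
      c • Measure.map (fun x : Fin r → ℝ => ∑ i, x i ^ 2) volume := by
  set f := fun x : Fin r → ℝ => ∑ i, x i ^ 2 with hf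
  have hfm : Measurable f := by fun_prop
  set b := (volume : Measure (Fin r → ℝ)) {x | ∑ i, x i ^ 2 ≤ 1}
  have hb0 : b ≠ 0 := vol_ball_pos r
  have hbt : b ≠ ∞ := (vol_ball_lt r 1).ne
  set a := (volume : Measure (Fin r → ℝ)) ({x | ∑ i, x i ^ 2 ≤ 1} ∩ G)
  have hat : a ≠ ∞ := ((measure_mono Set.inter_subset_left).trans_lt (vol_ball_lt r 1)).ne
  have hA : ∀ s, (Measure.map f (volume.restrict G)) (Set.Iic s) =
      volume ({x | ∑ i, x i ^ 2 ≤ s} ∩ G) := fun s => by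
    rw [Measure.map_apply hfm measurableSet_Iic,
      Measure.restrict_apply (hfm measurableSet_Iic)]; rfl
  have hB : ∀ s, (Measure.map f volume) (Set.Iic s) =
      volume {x : Fin r → ℝ | ∑ i, x i ^ 2 ≤ s} := fun s => by
    rw [Measure.map_apply hfm measurableSet_Iic]; rfl
  have hAB : ∀ s, (Measure.map f (volume.restrict G)) (Set.Iic s) =
      ((a / b) • Measure.map f volume) (Set.Iic s) := by
    intro s
    rw [Measure.smul_apply, hA, hB, smul_eq_mul]
    rcases le_or_gt s 0 with hs | hs
    · rw [vol_zero r hr s hs, mul_zero]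
      exact measure_mono_null Set.inter_subset_left (vol_zero r hr s hs)
    · have h1 := vol_scale r Set.univ (fun _ _ _ _ => trivial) s hs
      simp only [Set.inter_univ] at h1
      rw [vol_scale r G hcone s hs, h1]
      change _ * a = a / b * (_ * b)
      rw [mul_left_comm, ENNReal.div_mul_cancel hb0 hbt]
  refine ⟨a / b, ?_⟩
  refine Measure.ext_of_generateFrom_of_iUnion (C := Set.range Set.Iic)
    (fun n : ℕ => Set.Iic (n : ℝ)) ?_ isPiSystem_Iic ?_ (fun n => ⟨_, rfl⟩) ?_ ?_
  · exact borel_eq_generateFrom_Iic ℝ ▸ BorelSpace.measurable_eq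
  · exact iUnion_Iic_of_not_bddAbove_range (by
      rintro ⟨x, hx⟩
      obtain ⟨n, hn⟩ := exists_nat_gt x
      exact absurd (hx ⟨n, rfl⟩) (not_le.2 hn))
  · intro n
    rw [hA]
    exact ((measure_mono Set.inter_subset_left).trans_lt (vol_ball_lt r n)).ne
  · rintro _ ⟨s, rfl⟩
    exact hAB s

lemma map_wd {α : Type*} [MeasurableSpace α] (μ : Measure α) (f : α → ℝ) (hf : Measurable f)
    (g : ℝ → ℝ≥0∞) (hg : Measurable g) :
    Measure.map f (μ.withDensity (fun x => g (f x))) = (Measure.map f μ).withDensity g := by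
  ext s hs
  rw [Measure.map_apply hf hs, withDensity_apply _ (hf hs), withDensity_apply _ hs,
    setLIntegral_map hs hg hf]

lemma cone_indep (r : ℕ) (hr : 1 ≤ r) (G : Set (Fin r → ℝ)) (hG : MeasurableSet G)
    (hcone : ∀ t : ℝ, 0 < t → ∀ x ∈ G, t • x ∈ G) :
    Measure.map (fun x : Fin r → ℝ => ∑ i, x i ^ 2)
        ((Measure.pi fun _ : Fin r => gaussianReal 0 1).restrict G) =
      (Measure.pi fun _ : Fin r => gaussianReal 0 1) G •
        Measure.map (fun x : Fin r → ℝ => ∑ i, x i ^ 2)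
          (Measure.pi fun _ : Fin r => gaussianReal 0 1) := by
  obtain ⟨c, hc⟩ := map_vol_cone r hr G hcone
  set f := fun x : Fin r → ℝ => ∑ i, x i ^ 2 with hf
  have hfm : Measurable f := by fun_prop
  set g : ℝ → ℝ≥0∞ := fun t =>
    ENNReal.ofReal (((√(2 * Real.pi))⁻¹) ^ r * Real.exp (-t / 2)) with hg
  have hgm : Measurable g := by fun_prop
  set γ := (Measure.pi fun _ : Fin r => gaussianReal 0 1) with hγ
  have hd : γ = volume.withDensity (fun x => g (f x)) := by
    rw [hγ, pi_gauss_density]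
    simp only [prod_pdf, hg, hf]
  have key : Measure.map f (γ.restrict G) = c • Measure.map f γ := by
    rw [hd, restrict_withDensity hG, map_wd _ f hfm g hgm, hc, map_wd _ f hfm g hgm,
      withDensity_smul_measure]
  have hcG : γ G = c := by
    have h := congrArg (fun m => m Set.univ) key
    simpa [Measure.map_apply hfm MeasurableSet.univ] using h
  rw [hcG, key]

lemma exists_factor (n r : ℕ) (P : Matrix (Fin n) (Fin n) ℝ)
    (hsymm : P.IsSymm) (hidem : P * P = P) (hrank : P.rank = r) :
    ∃ B : Matrix (Fin r) (Fin n) ℝ, B * B.transpose = 1 ∧ B.transpose * B = P := by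
  set V := LinearMap.range (Matrix.toLpLin 2 2 P) with hV
  have hdim : Module.finrank ℝ V = r := by
    rw [← hrank, Matrix.rank_eq_finrank_range_toLin P (EuclideanSpace.basisFun (Fin n) ℝ).toBasis
      (EuclideanSpace.basisFun (Fin n) ℝ).toBasis]
    rw [hV, Matrix.toLpLin_eq_toLin]
    rfl
  let b : OrthonormalBasis (Fin r) ℝ V := (stdOrthonormalBasis ℝ V).reindex (finCongr hdim)
  let B : Matrix (Fin r) (Fin n) ℝ := Matrix.of fun i j => (b i : EuclideanSpace ℝ (Fin n)) j
  have hB : ∀ i j, B i j = (b i : EuclideanSpace ℝ (Fin n)) j := fun _ _ => rfl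
  have h1 : B * B.transpose = 1 := by
    ext i j
    have := (orthonormal_iff_ite.1 b.orthonormal) j i
    rw [Submodule.coe_inner, PiLp.inner_apply] at this
    simp only [Matrix.mul_apply, Matrix.transpose_apply, hB, Matrix.one_apply]
    simpa [eq_comm] using this
  have hPb : ∀ i, P.mulVec (B i) = B i := by
    intro i
    obtain ⟨x, hx⟩ := (b i).2
    have : B i = P.mulVec x.ofLp := by
      ext j; rw [hB, ← hx]; simp [Matrix.toLpLin_apply]
    rw [this, Matrix.mulVec_mulVec, hidem]
  have h2 : P * B.transpose = B.transpose := by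
    ext i j
    exact congrFun (hPb j) i
  have h3 : B.transpose * B * P = P := by
    ext j k
    let v : V := ⟨Matrix.toLpLin 2 2 P (EuclideanSpace.single k 1), ⟨_, rfl⟩⟩
    have hv : ∀ j, (v : EuclideanSpace ℝ (Fin n)) j = P j k := fun j => by
      simp [v, Matrix.toLpLin_apply]
    have h := congrArg (fun w : V => (w : EuclideanSpace ℝ (Fin n)) j) (b.sum_repr' v)
    simp only [Submodule.coe_inner, PiLp.inner_apply, hv] at h
    rw [← h, Matrix.mul_assoc]
    simp [Matrix.mul_apply, hB, mul_comm]
  refine ⟨B, h1, ?_⟩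
  have h4 : P * (B.transpose * B) = B.transpose * B := by rw [← Matrix.mul_assoc, h2]
  have h5 := congrArg Matrix.transpose h4
  simp only [Matrix.transpose_mul, Matrix.transpose_transpose, hsymm.eq] at h5
  rw [← h5, h3]

lemma map_gauss (n r : ℕ) (B : Matrix (Fin r) (Fin n) ℝ) (h : B * B.transpose = 1) :
    Measure.map B.mulVec (Measure.pi fun _ : Fin n => gaussianReal 0 1) =
      Measure.pi fun _ : Fin r => gaussianReal 0 1 := by
  have hBm : Measurable B.mulVec := (Matrix.mulVecLin B).continuous_of_finiteDimensional.measurable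
  have key : ((Measure.pi fun _ : Fin n => gaussianReal 0 1).map B.mulVec).map (WithLp.toLp 2) =
      (Measure.pi fun _ : Fin r => gaussianReal 0 1).map (WithLp.toLp 2) := by
    have : IsProbabilityMeasure ((Measure.pi fun _ : Fin n => gaussianReal 0 1).map B.mulVec) :=
      Measure.isProbabilityMeasure_map hBm.aemeasurable
    have : IsProbabilityMeasure
        (((Measure.pi fun _ : Fin n => gaussianReal 0 1).map B.mulVec).map (WithLp.toLp 2)) :=
      Measure.isProbabilityMeasure_map (by fun_prop)
    have : IsProbabilityMeasure
        ((Measure.pi fun _ : Fin r => gaussianReal 0 1).map (WithLp.toLp 2)) :=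
      Measure.isProbabilityMeasure_map (by fun_prop)
    apply Measure.ext_of_charFun (E := EuclideanSpace ℝ (Fin r))
    ext t
    rw [map_pi_eq_stdGaussian, charFun_stdGaussian]
    let u : EuclideanSpace ℝ (Fin n) := WithLp.toLp 2 (B.transpose.mulVec t.ofLp)
    have hu : ‖u‖ = ‖t‖ := by
      have : ‖u‖ ^ 2 = ‖t‖ ^ 2 := by
        rw [← real_inner_self_eq_norm_sq, ← real_inner_self_eq_norm_sq,
          EuclideanSpace.inner_eq_star_dotProduct, EuclideanSpace.inner_eq_star_dotProduct]
        simp only [star_trivial, u]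
        rw [Matrix.dotProduct_mulVec, Matrix.vecMul_transpose, Matrix.mulVec_mulVec, h,
          Matrix.one_mulVec]
      exact (sq_eq_sq₀ (norm_nonneg _) (norm_nonneg _)).1 this
    rw [← hu, ← charFun_stdGaussian, ← map_pi_eq_stdGaussian, charFun_apply, charFun_apply,
      integral_map (by fun_prop) (Measurable.aestronglyMeasurable (by fun_prop)),
      integral_map hBm.aemeasurable (Measurable.aestronglyMeasurable (by fun_prop)),
      integral_map (by fun_prop) (Measurable.aestronglyMeasurable (by fun_prop))]
    refine integral_congr_ae (ae_of_all _ fun x => ?_)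
    have : inner ℝ (WithLp.toLp 2 (B.mulVec x)) t = inner ℝ (WithLp.toLp 2 x) u := by
      rw [EuclideanSpace.inner_eq_star_dotProduct, EuclideanSpace.inner_eq_star_dotProduct]
      simp only [star_trivial, u]
      rw [Matrix.dotProduct_mulVec, Matrix.mulVec_transpose]
    simp only [this]
  have hid : ∀ m : Measure (Fin r → ℝ),
      (m.map (WithLp.toLp 2)).map (WithLp.ofLp) = m := fun m => by
    rw [Measure.map_map (by fun_prop) (by fun_prop)]
    exact Measure.map_id
  rw [← hid (Measure.map B.mulVec _), key, hid]

theorem stmt9 (n r : ℕ) (hr : 1 ≤ r) (P : Matrix (Fin n) (Fin n) ℝ)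
    (hsymm : P.IsSymm) (hidem : P * P = P) (hrank : P.rank = r)
    (F : Set (Fin n → ℝ)) (hFmeas : MeasurableSet F)
    (hcone : ∀ t : ℝ, 0 < t → ∀ x ∈ F, t • x ∈ F)
    (hrange : ∀ x ∈ F, P.mulVec x = x)
    (hpos : 0 < (Measure.pi fun _ : Fin n => gaussianReal 0 1) {z | P.mulVec z ∈ F}) :
    Measure.map (fun z : Fin n → ℝ => ∑ i, (P.mulVec z i) ^ 2)
      ((Measure.pi fun _ : Fin n => gaussianReal 0 1)[|{z | P.mulVec z ∈ F}]) =
    chiSq r := by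
  obtain ⟨B, h1, h2⟩ := exists_factor n r P hsymm hidem hrank
  have hBm : Measurable B.mulVec := (Matrix.mulVecLin B).continuous_of_finiteDimensional.measurable
  have hBtm : Measurable B.transpose.mulVec :=
    (Matrix.mulVecLin B.transpose).continuous_of_finiteDimensional.measurable
  have hP : ∀ z, P.mulVec z = B.transpose.mulVec (B.mulVec z) := fun z => by
    rw [Matrix.mulVec_mulVec, h2]
  have hnorm : (fun z : Fin n → ℝ => ∑ i, (P.mulVec z i) ^ 2) =
      (fun x : Fin r → ℝ => ∑ i, x i ^ 2) ∘ B.mulVec := by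
    funext z
    have : P.mulVec z ⬝ᵥ P.mulVec z = B.mulVec z ⬝ᵥ B.mulVec z := by
      rw [hP, Matrix.dotProduct_mulVec, Matrix.vecMul_transpose, Matrix.mulVec_mulVec, h1,
        Matrix.one_mulVec]
    simpa [dotProduct, pow_two] using this
  set G : Set (Fin r → ℝ) := B.transpose.mulVec ⁻¹' F with hGdef
  have hG : MeasurableSet G := hBtm hFmeas
  have hset : {z | P.mulVec z ∈ F} = B.mulVec ⁻¹' G := by
    ext z; simp [hGdef, hP]
  have hGc : ∀ t : ℝ, 0 < t → ∀ x ∈ G, t • x ∈ G := by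
    intro t ht x hx
    simp only [hGdef, Set.mem_preimage, Matrix.mulVec_smul] at hx ⊢
    exact hcone t ht _ hx
  have hmap := map_gauss n r B h1
  have hmeas : (Measure.pi fun _ : Fin n => gaussianReal 0 1) (B.mulVec ⁻¹' G) =
      (Measure.pi fun _ : Fin r => gaussianReal 0 1) G := by
    rw [← hmap, Measure.map_apply hBm hG]
  rw [hset, hmeas] at hpos
  rw [hset, hnorm, ProbabilityTheory.cond, hmeas, Measure.map_smul,
    ← Measure.map_map (by fun_prop) hBm, ← Measure.restrict_map hBm hG, hmap,
    cone_indep r hr G hG hGc, smul_smul, ENNReal.inv_mul_cancel hpos.ne' (measure_ne_top _ _),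
    one_smul]
  rfl
end

section
/- Let Y ~ N(μ, I_p) with μ ≤ 0 componentwise and α ∈ (0,1). Define N = #{i : Yᵢ ≥ 0}, LR = ∑ᵢ Yᵢ²·1{Yᵢ ≥ 0}, and q(Y,α) = q_{χ²(N)}(1-α) (with q_{χ²(0)} = 0). Then P(LR > q(Y,α)) ≤ (1 - 2^{-p}) α. -/
open MeasureTheory ProbabilityTheory

lemma rearr (a b c d : ENNReal) (h1 : a ≤ b) (h2 : d ≤ c) : a * c + b * d ≤ a * d + b * c := by
  obtain ⟨e, rfl⟩ := exists_add_of_le h1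
  obtain ⟨f, rfl⟩ := exists_add_of_le h2
  calc _ = a * d + a * d + a * f + e * d := by ring
    _ ≤ a * d + a * d + a * f + e * d + e * f := le_self_add
    _ = _ := by ring

lemma half_Ici : gaussianReal 0 1 (Set.Ici 0) = 1/2 ∧ gaussianReal 0 1 (Set.Iio 0) = 1/2 := by
  have := nullSingletonClass_gaussianReal (μ := 0) (v := 1) (by simp)
  have h1 : gaussianReal 0 1 (Set.Ici 0) = gaussianReal 0 1 (Set.Iio 0) := by
    have h := gaussianReal_map_neg (μ := 0) (v := 1)
    rw [neg_zero] at h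
    conv_lhs => rw [← h]
    rw [Measure.map_apply (by fun_prop) measurableSet_Ici, measure_congr (Iio_ae_eq_Iic (a := (0:ℝ)) (μ := gaussianReal 0 1)) ]
    · congr 1
      ext x; simp
  have h2 : gaussianReal 0 1 (Set.Ici 0) + gaussianReal 0 1 (Set.Iio 0) = 1 := by
    rw [← Set.compl_Ici, measure_add_measure_compl measurableSet_Ici, measure_univ]
  rw [← h1] at h2 ⊢
  rw [← two_mul] at h2
  have : gaussianReal 0 1 (Set.Ici 0) = 1/2 := by
    rw [ENNReal.eq_div_iff (by simp) (by simp), h2]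
  exact ⟨this, this⟩

lemma half_le (μ : ℝ) (hμ : μ ≤ 0) : 1/2 ≤ gaussianReal μ 1 (Set.Iio 0) := by
  rw [← half_Ici.2]
  have h := gaussianReal_map_add_const (μ := 0) (v := 1) μ
  rw [zero_add] at h
  rw [← h, Measure.map_apply (by fun_prop) measurableSet_Iio]
  apply measure_mono
  intro x hx
  simp at hx ⊢
  linarith

lemma half_int (g : ℝ → ENNReal) (hg : Measurable g) (hm : ∀ x y, |x| ≤ |y| → g x ≤ g y) :
    ∫⁻ x, g x ∂gaussianReal 0 1 = 2 * ∫⁻ x in Set.Ici 0, g x ∂gaussianReal 0 1 := by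
  have := nullSingletonClass_gaussianReal (μ := 0) (v := 1) (by simp)
  rw [← lintegral_add_compl _ (measurableSet_Ici (a := (0:ℝ))), two_mul]
  congr 1
  rw [Set.compl_Ici, setLIntegral_congr (Iio_ae_eq_Iic (a := (0:ℝ)) (μ := gaussianReal 0 1))]
  have h := gaussianReal_map_neg (μ := 0) (v := 1)
  rw [neg_zero] at h
  conv_lhs => rw [← h]
  rw [setLIntegral_map measurableSet_Iic hg (by fun_prop)]
  have : (fun x : ℝ => -x) ⁻¹' Set.Iic 0 = Set.Ici 0 := by ext; simp
  rw [this]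
  exact lintegral_congr fun x => le_antisymm (hm _ _ (by simp)) (hm _ _ (by simp))

lemma cheb (ν : Measure ℝ) [SFinite ν] (s : Set ℝ) (hs : MeasurableSet s) (g h : ℝ → ENNReal) (hg : Measurable g) (hh : Measurable h)
    (H : ∀ x ∈ s, ∀ y ∈ s, x ≤ y → g x ≤ g y ∧ h y ≤ h x) :
    ν s * ∫⁻ x in s, g x * h x ∂ν ≤ (∫⁻ x in s, g x ∂ν) * ∫⁻ x in s, h x ∂ν := by
  have key : ∀ x ∈ s, ∀ y ∈ s, g x * h x + g y * h y ≤ g x * h y + g y * h x := by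
    intro x hx y hy
    rcases le_total x y with h | h
    · exact rearr _ _ _ _ (H x hx y hy h).1 (H x hx y hy h).2
    · have := rearr _ _ _ _ (H y hy x hx h).1 (H y hy x hx h).2
      rw [add_comm, add_comm (g x * _)]
      exact this
  have k1 : ∀ x ∈ s, g x * h x * ν s + ∫⁻ y in s, g y * h y ∂ν ≤ g x * ∫⁻ y in s, h y ∂ν + h x * ∫⁻ y in s, g y ∂ν := by
    intro x hx
    have := setLIntegral_mono' (μ := ν) hs (key x hx)
    rw [lintegral_add_left (by fun_prop), lintegral_add_left (by fun_prop), lintegral_const_mul _ hh, lintegral_mul_const _ hg] at this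
    simp only [lintegral_const, Measure.restrict_apply_univ] at this
    rwa [mul_comm (h x)]
  have := setLIntegral_mono' (μ := ν) hs k1
  rw [lintegral_add_left (by fun_prop), lintegral_add_left (by fun_prop), lintegral_mul_const _ (by fun_prop), lintegral_mul_const _ (by fun_prop), lintegral_mul_const _ (by fun_prop)] at this
  simp only [lintegral_const, Measure.restrict_apply_univ] at this
  rw [mul_comm _ (ν s), mul_comm (∫⁻ x in s, h x ∂ν), ← two_mul, ← two_mul] at this
  exact (ENNReal.mul_le_mul_iff_right (by simp) (by simp)).1 this

lemma gauss_dens (μ : ℝ) : gaussianReal μ 1 = (gaussianReal 0 1).withDensity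
    (fun x => ENNReal.ofReal (Real.exp (μ * x - μ^2/2))) := by
  rw [gaussianReal_of_var_ne_zero _ (by simp), gaussianReal_of_var_ne_zero _ (by simp), ← withDensity_mul _ (by fun_prop) (by fun_prop)]
  congr 1
  ext x
  simp only [gaussianPDF, gaussianPDFReal, Pi.mul_apply]
  rw [← ENNReal.ofReal_mul (by positivity), mul_assoc (_⁻¹), ← Real.exp_add]
  congr 3
  simp
  ring

lemma dom1 (μ : ℝ) (hμ : μ ≤ 0) (g : ℝ → ENNReal) (hg : Measurable g) (hm : ∀ x y, |x| ≤ |y| → g x ≤ g y) :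
    ∫⁻ x, g x ∂((gaussianReal μ 1).restrict (Set.Ici 0)) ≤
      gaussianReal μ 1 (Set.Ici 0) * ∫⁻ x, g x ∂gaussianReal 0 1 := by
  have c := cheb (gaussianReal 0 1) (Set.Ici 0) measurableSet_Ici g
    (fun x => ENNReal.ofReal (Real.exp (μ * x - μ^2/2))) hg (by fun_prop) (by
      intro x hx y hy h
      simp at hx hy
      refine ⟨hm _ _ (by rwa [abs_of_nonneg hx, abs_of_nonneg hy]), ?_⟩
      apply ENNReal.ofReal_le_ofReal
      apply Real.exp_le_exp.2
      nlinarith)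
  rw [half_int g hg hm, gauss_dens, withDensity_apply _ measurableSet_Ici, restrict_withDensity measurableSet_Ici,
    lintegral_withDensity_eq_lintegral_mul _ (by fun_prop) hg]
  rw [half_Ici.1] at c
  simp only [Pi.mul_apply, mul_comm _ (g _)]
  have := mul_le_mul_right c 2
  rw [← mul_assoc] at this
  rw [show (2:ENNReal) * (1/2) = 1 by simp [ENNReal.mul_inv_cancel], one_mul] at this
  refine this.trans (le_of_eq ?_)
  ring

lemma domN (n : ℕ) (m : Fin n → Measure ℝ) [∀ i, SigmaFinite (m i)] (c : Fin n → ENNReal)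
    (ν : Measure ℝ) [SigmaFinite ν] (R : Fin n → ℝ → ℝ → Prop) (hR : ∀ i x, R i x x)
    (D : ∀ i, ∀ g : ℝ → ENNReal, Measurable g → (∀ x y, R i x y → g x ≤ g y) →
      ∫⁻ x, g x ∂(m i) ≤ c i * ∫⁻ x, g x ∂ν)
    (f : (Fin n → ℝ) → ENNReal) (hf : Measurable f)
    (hm : ∀ x y, (∀ i, R i (x i) (y i)) → f x ≤ f y) :
    ∫⁻ x, f x ∂(Measure.pi m) ≤ (∏ i, c i) * ∫⁻ x, f x ∂(Measure.pi fun _ => ν) := by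
  induction n with
  | zero => 
    simp
    rw [Measure.pi_of_empty, Measure.pi_of_empty]
  | succ n ih =>
    have hc : Measurable fun z : ℝ × (Fin n → ℝ) => f (Fin.cons z.1 z.2) := by
      refine hf.comp (measurable_pi_iff.2 fun i => ?_)
      refine Fin.cases ?_ (fun i => ?_) i
      · simpa using measurable_fst
      · simp only [Fin.cons_succ]; fun_prop
    have e (m : Fin (n+1) → Measure ℝ) [∀ i, SigmaFinite (m i)] :
        ∫⁻ x, f x ∂(Measure.pi m) =
          ∫⁻ x, ∫⁻ y, f (Fin.cons x y) ∂(Measure.pi fun j => m (Fin.succ j)) ∂(m 0) := by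
      have e1 := (measurePreserving_piFinSuccAbove m 0).symm
      rw [← e1.lintegral_comp hf, ← lintegral_prod _ hc.aemeasurable]
      simp only [Fin.zero_succAbove]
      apply lintegral_congr
      intro z
      congr 1
      simp [MeasurableEquiv.piFinSuccAbove_symm_apply, Fin.insertNthEquiv]
    rw [e m, e (fun _ => ν), Fin.prod_univ_succ]
    have hc1 (x : ℝ) : Measurable fun y : Fin n → ℝ => f (Fin.cons x y) := hc.comp measurable_prodMk_left
    calc _ ≤ ∫⁻ x, (∏ i : Fin n, c i.succ) * ∫⁻ y, f (Fin.cons x y) ∂(Measure.pi fun _ => ν) ∂(m 0) := by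
          apply lintegral_mono
          intro x
          refine ih (fun j => m j.succ) (fun j => c j.succ) (fun j => R j.succ) (fun j => hR _) (fun j => D _) _ (hc1 x) ?_
          intro y z h
          apply hm
          refine Fin.cases ?_ (fun i => ?_)
          · simpa using hR 0 x
          · simpa using h i
      _ = (∏ i : Fin n, c i.succ) * ∫⁻ x, ∫⁻ y, f (Fin.cons x y) ∂(Measure.pi fun _ => ν) ∂(m 0) :=
          lintegral_const_mul _ hc.lintegral_prod_right'
      _ ≤ (∏ i : Fin n, c i.succ) * (c 0 * ∫⁻ x, ∫⁻ y, f (Fin.cons x y) ∂(Measure.pi fun _ => ν) ∂ν) := by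
          gcongr
          refine D 0 _ hc.lintegral_prod_right' ?_
          intro x y h
          apply lintegral_mono
          intro z
          apply hm
          refine Fin.cases ?_ (fun i => ?_)
          · simpa using h
          · simpa using hR _ _
      _ = _ := by ring

lemma marg (p : ℕ) (S : Finset (Fin p)) (q : ℝ) :
    (Measure.pi fun _ : Fin p => gaussianReal 0 1) {y | q < ∑ i ∈ S, (y i)^2} =
     Measure.map (fun x : Fin S.card → ℝ => ∑ i, (x i) ^ 2)
    (Measure.pi fun _ : Fin S.card => gaussianReal 0 1) {x | q < x} := by
  have h1 : iIndepFun (fun (i : Fin p) (y : Fin p → ℝ) => y i) (Measure.pi fun _ : Fin p => gaussianReal 0 1) :=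
    iIndepFun_pi (X := fun _ => id) (fun _ => aemeasurable_id)
  have h2 := h1.precomp (g := S.orderEmbOfFin rfl) (S.orderEmbOfFin rfl).injective
  rw [iIndepFun_iff_map_fun_eq_pi_map (fun i => (measurable_pi_apply _).aemeasurable)] at h2
  have h3 : ∀ i : Fin p, Measure.map (fun y : Fin p → ℝ => y i) (Measure.pi fun _ : Fin p => gaussianReal 0 1) = gaussianReal 0 1 := 
    fun i => (measurePreserving_eval (fun _ : Fin p => gaussianReal 0 1) i).map_eq
  simp only [Function.comp_apply, h3] at h2
  rw [← h2, Measure.map_map (by fun_prop) (by fun_prop), Measure.map_apply (by fun_prop) (show MeasurableSet {x : ℝ | q < x} from measurableSet_Ioi)]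
  congr 1
  ext y
  simp
  rw [← Finset.sum_coe_sort S, ← (S.orderIsoOfFin rfl).toEquiv.sum_comp]
  rfl

lemma one_set (p : ℕ) (μ : Fin p → ℝ) (hμ : ∀ i, μ i ≤ 0) (S : Finset (Fin p)) (q : ℝ) :
    (Measure.pi fun i : Fin p => gaussianReal (μ i) 1)
      {y | q < (∑ i, if 0 ≤ y i then (y i) ^ 2 else 0) ∧ (Finset.univ.filter fun i => 0 ≤ y i) = S}
    ≤ (∏ i, if i ∈ S then gaussianReal (μ i) 1 (Set.Ici 0) else gaussianReal (μ i) 1 (Set.Iio 0)) *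
      chiSq S.card {x | q < x} := by
  classical
  set A : Set (Fin p → ℝ) := {y | q < ∑ i ∈ S, (y i)^2} with hA
  have mA : MeasurableSet A := measurableSet_lt measurable_const (by fun_prop)
  set t : Fin p → Set ℝ := fun i => if i ∈ S then Set.Ici 0 else Set.Iio 0 with ht
  have h1 : {y : Fin p → ℝ | q < (∑ i, if 0 ≤ y i then (y i) ^ 2 else 0) ∧ (Finset.univ.filter fun i => 0 ≤ y i) = S}
      ⊆ A ∩ Set.univ.pi t := by
    rintro y ⟨h1, h2⟩
    constructor
    · rw [← Finset.sum_filter, h2] at h1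
      exact h1
    · intro i _
      by_cases hi : i ∈ S
      · simp only [ht, hi, if_true]
        rw [← h2] at hi
        simpa using hi
      · simp only [ht, hi, if_false]
        rw [← h2] at hi
        simpa using hi
  refine (measure_mono h1).trans ?_
  rw [← Measure.restrict_apply mA, Measure.restrict_pi_pi, chiSq, ← marg, ← lintegral_indicator_one mA,
    ← lintegral_indicator_one mA]
  refine domN p _ _ _ (fun i x y => i ∈ S → |x| ≤ |y|) (fun i x _ => le_rfl) ?_ _
    (measurable_one.indicator mA) ?_
  · intro i g hg hm
    by_cases hi : i ∈ S
    · simp only [ht, hi, if_true]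
      exact dom1 _ (hμ i) g hg (fun x y h => hm x y fun _ => h)
    · simp only [ht, hi, if_false]
      have : g = fun _ => g 0 := by
        ext x
        exact le_antisymm (hm _ _ fun h => absurd h hi) (hm _ _ fun h => absurd h hi)
      rw [this]
      simp [mul_comm]
  · intro x y h
    have : x ∈ A → y ∈ A := fun hx => lt_of_lt_of_le hx
      (Finset.sum_le_sum fun i hi => sq_le_sq.2 (h i hi))
    by_cases hx : x ∈ A
    · simp [hx, this hx]
    · simp [hx]

/-- for Y ~ N(μ, I_p) with μ ≤ 0, the adaptive test comparing
LR = ∑ Yᵢ²1{Yᵢ≥0} with the (1-α)-quantile of χ²(N), N = #{i : Yᵢ ≥ 0},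
has level at most (1 - 2^{-p})α. -/
theorem stmt14 (p : ℕ) (μ : Fin p → ℝ) (hμ : ∀ i, μ i ≤ 0)
    (α : ℝ) (hα : α ∈ Set.Ioo (0:ℝ) 1)
    (q : ℕ → ℝ) (hq0 : q 0 = 0)
    (hq : ∀ k, 1 ≤ k → chiSq k {x | q k < x} = ENNReal.ofReal α) :
    (Measure.pi fun i : Fin p => gaussianReal (μ i) 1)
      {y | (∑ i, if 0 ≤ y i then (y i) ^ 2 else 0) >
            q (Finset.univ.filter fun i => 0 ≤ y i).card} ≤
    ENNReal.ofReal ((1 - 1 / 2 ^ p) * α) := by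
  classical
  set C : Finset (Fin p) → ENNReal := fun S => 
    ∏ i, if i ∈ S then gaussianReal (μ i) 1 (Set.Ici 0) else gaussianReal (μ i) 1 (Set.Iio 0) with hC
  have hsum : ∑ S, C S = 1 := by
    have h := Finset.prod_add (fun i => gaussianReal (μ i) 1 (Set.Ici 0))
      (fun i => gaussianReal (μ i) 1 (Set.Iio 0)) Finset.univ
    have h1 : ∀ i, gaussianReal (μ i) 1 (Set.Ici 0) + gaussianReal (μ i) 1 (Set.Iio 0) = 1 := by
      intro i
      rw [← Set.compl_Ici, measure_add_measure_compl measurableSet_Ici, measure_univ]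
    simp only [h1, Finset.prod_const_one, Finset.powerset_univ] at h
    rw [h]
    refine Finset.sum_congr rfl fun S _ => ?_
    simp only [hC]
    rw [Finset.prod_ite]
    congr 2 <;> ext <;> simp
  rw [← Finset.add_sum_erase _ _ (Finset.mem_univ ∅)] at hsum
  have hC0 : ENNReal.ofReal (1 / 2 ^ p) ≤ C ∅ := by
    simp only [hC, Finset.notMem_empty, if_false]
    calc ENNReal.ofReal (1 / 2 ^ p) = ∏ i : Fin p, (1/2 : ENNReal) := by
          rw [← one_div_pow, ENNReal.ofReal_pow (by norm_num)]
          simp [ENNReal.ofReal_inv_of_pos]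
      _ ≤ _ := Finset.prod_le_prod' fun i _ => half_le _ (hμ i)
  have hT : ∑ S ∈ Finset.univ.erase ∅, C S ≤ ENNReal.ofReal (1 - 1 / 2 ^ p) := by
    rw [ENNReal.ofReal_sub _ (by positivity), ENNReal.ofReal_one]
    apply ENNReal.le_sub_of_add_le_left (by simp)
    rw [← hsum]
    gcongr
  calc _ ≤ (Measure.pi fun i : Fin p => gaussianReal (μ i) 1) (⋃ S ∈ Finset.univ.erase (∅ : Finset (Fin p)),
        {y | q S.card < (∑ i, if 0 ≤ y i then (y i) ^ 2 else 0) ∧ (Finset.univ.filter fun i => 0 ≤ y i) = S}) := by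
        apply measure_mono
        intro y hy
        simp only [Set.mem_ofPred_eq, gt_iff_lt] at hy
        simp only [Set.mem_iUnion]
        refine ⟨Finset.univ.filter fun i => 0 ≤ y i, ?_, hy, rfl⟩
        simp only [Finset.mem_erase, Finset.mem_univ, and_true]
        intro h
        rw [← Finset.sum_filter, h] at hy
        simp [hq0] at hy
    _ ≤ ∑ S ∈ Finset.univ.erase (∅ : Finset (Fin p)), C S * ENNReal.ofReal α := by
        refine (measure_biUnion_finset_le _ _).trans (Finset.sum_le_sum fun S hS => ?_)
        have hS' : 1 ≤ S.card := Finset.card_pos.2 (Finset.nonempty_iff_ne_empty.2 (Finset.ne_of_mem_erase hS))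
        rw [← hq _ hS']
        exact one_set p μ hμ S _
    _ = (∑ S ∈ Finset.univ.erase (∅ : Finset (Fin p)), C S) * ENNReal.ofReal α := by rw [Finset.sum_mul]
    _ ≤ ENNReal.ofReal (1 - 1 / 2 ^ p) * ENNReal.ofReal α := by gcongr
    _ = _ := by rw [ENNReal.ofReal_mul' hα.1.le]
end
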